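/- Let C be a hybrid circuit and g a ⊠-gate of C. Then there is exactly one set-valued gate δ(g) of C that is not a ⊠-gate and has a directed path to g in which all gates other than δ(g) are ⊠-gates. Moreover, for every valuation ν of C with ⟦g⟧_ν ≠ ∅, we have ⟦g⟧_ν = ⟦δ(g)⟧_ν. -/

import Mathlib

namespace MSOEnum

inductive GateType : Type
  | svar | bvar | union | prod | box | band | bor | bnot
  deriving DecidableEq

def GateType.isBoolean : GateType → Prop
  | .bvar => True
  | .band => True
  | .bor => True
  | .bnot => True
  | _ => False

/-- A hybrid circuit: a finite DAG of gates, where `wire g g'` means that `g`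
is an input of `g'`, with an output gate and gate types satisfying the
structural requirements of hybrid circuits. -/
structure HybridCircuit (α : Type) where
  gates : Finset α
  wire : α → α → Prop
  wire_mem : ∀ a b, wire a b → a ∈ gates ∧ b ∈ gates
  acyclic : WellFounded wire
  τ : α → GateType
  out : α
  out_mem : out ∈ gates
  out_setValued : ¬ (τ out).isBoolean
  var_no_input : ∀ g, (τ g = GateType.svar ∨ τ g = GateType.bvar) → ∀ g', ¬ wire g' g
  boolGate_inputs : ∀ g, (τ g = GateType.band ∨ τ g = GateType.bor ∨ τ g = GateType.bnot) →
    ∀ g', wire g' g → (τ g').isBoolean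
  bnot_input : ∀ g ∈ gates, τ g = GateType.bnot → ∃! g', wire g' g
  setGate_inputs : ∀ g, (τ g = GateType.union ∨ τ g = GateType.prod) →
    ∀ g', wire g' g → ¬ (τ g').isBoolean
  prod_inputs : ∀ g ∈ gates, τ g = GateType.prod →
    (∀ g', ¬ wire g' g) ∨
    ∃ g₁ g₂, g₁ ≠ g₂ ∧ wire g₁ g ∧ wire g₂ g ∧ ∀ g', wire g' g → g' = g₁ ∨ g' = g₂
  box_inputs : ∀ g ∈ gates, τ g = GateType.box →
    ∃ gs gb, ¬ (τ gs).isBoolean ∧ (τ gb).isBoolean ∧ wire gs g ∧ wire gb g ∧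
      ∀ g', wire g' g → g' = gs ∨ g' = gb

variable {α : Type}

open Classical in
/-- The Boolean value `⟨g⟩_ν` captured by each (Boolean) gate, computed bottom-up. -/
noncomputable def bval (C : HybridCircuit α) (ν : α → Bool) : α → Bool :=
  C.acyclic.fix fun g rec =>
    match C.τ g with
    | .bvar => ν g
    | .band => decide (∀ g' (h : C.wire g' g), rec g' h = true)
    | .bor => decide (∃ g', ∃ h : C.wire g' g, rec g' h = true)
    | .bnot => decide (∀ g' (h : C.wire g' g), rec g' h = false)
    | _ => false

open Classical in
/-- The set `⟦g⟧_ν` of assignments captured by each (set-valued) gate, computed bottom-up. -/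
noncomputable def sval (C : HybridCircuit α) (ν : α → Bool) : α → Set (Set α) :=
  C.acyclic.fix fun g rec =>
    match C.τ g with
    | .svar => {{g}}
    | .union => {a | ∃ g', ∃ h : C.wire g' g, a ∈ rec g' h}
    | .prod =>
        if ∀ g', ¬ C.wire g' g then {∅}
        else {a | ∃ g₁ g₂, ∃ (h₁ : C.wire g₁ g) (h₂ : C.wire g₂ g), g₁ ≠ g₂ ∧
          ∃ a₁ ∈ rec g₁ h₁, ∃ a₂ ∈ rec g₂ h₂, a = a₁ ∪ a₂}
    | .box => {a | (∃ g', ∃ h : C.wire g' g, ¬ (C.τ g').isBoolean ∧ a ∈ rec g' h) ∧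
        ∀ g'', C.wire g'' g → (C.τ g'').isBoolean → bval C ν g'' = true}
    | _ => (∅ : Set (Set α))

open Classical in
/-- The partial evaluation `ω_ν`. -/
noncomputable def omegaEval (C : HybridCircuit α) (ν : α → Bool) (g : α) : Bool :=
  if (C.τ g).isBoolean then bval C ν g else decide (sval C ν g).Nonempty

def boxStep (C : HybridCircuit α) (a b : α) : Prop := C.wire a b ∧ C.τ b = GateType.box

/-- A ⊠-path from `g'` to `g` that is live under `ν`. -/
def liveBoxPath (C : HybridCircuit α) (ν : α → Bool) (g' g : α) : Prop :=
  ∃ g'', Relation.ReflTransGen (boxStep C) g' g'' ∧ C.wire g'' g ∧ omegaEval C ν g'' = true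

/-- A ∪-path from `g'` to `g` that is live under `ν`. -/
def liveUnionPath (C : HybridCircuit α) (ν : α → Bool) (g' g : α) : Prop :=
  ∃ g'', Relation.ReflTransGen
      (fun a b => liveBoxPath C ν a b ∧ C.τ b = GateType.union) g' g'' ∧
    liveBoxPath C ν g'' g

def isExit (C : HybridCircuit α) (g : α) : Prop :=
  C.τ g = GateType.prod ∨ C.τ g = GateType.svar

/-- The set `D^ν_g` of exits having a live ∪-path to `g` under `ν`. -/
def exitsOf (C : HybridCircuit α) (ν : α → Bool) (g : α) : Set α :=
  {g' | isExit C g' ∧ liveUnionPath C ν g' g}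

def deterministic (C : HybridCircuit α) : Prop :=
  ∀ (ν : α → Bool), ∀ g ∈ C.gates, C.τ g = GateType.union →
    ∀ g₁ g₂, C.wire g₁ g → C.wire g₂ g → g₁ ≠ g₂ →
      Disjoint (sval C ν g₁) (sval C ν g₂)

def decomposable (C : HybridCircuit α) : Prop :=
  ∀ g ∈ C.gates, C.τ g = GateType.prod →
    ∀ g₁ g₂, C.wire g₁ g → C.wire g₂ g → g₁ ≠ g₂ →
      ∀ v, C.τ v = GateType.svar →
        ¬ (Relation.ReflTransGen C.wire v g₁ ∧ Relation.ReflTransGen C.wire v g₂)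

def isDDNNF (C : HybridCircuit α) : Prop := decomposable C ∧ deterministic C

/-- The wire `(g, g')` (with `g` set-valued) is pure under `ν`. -/
def pureWire (C : HybridCircuit α) (ν : α → Bool) (g g' : α) : Prop :=
  C.wire g g' ∧ ¬ (C.τ g).isBoolean ∧
    (C.τ g' = GateType.union ∨
     (C.τ g' = GateType.box ∧
       ∀ g'', C.wire g'' g' → (C.τ g'').isBoolean → bval C ν g'' = true) ∨
     (C.τ g' = GateType.prod ∧ ∃ g'', C.wire g'' g' ∧ g'' ≠ g ∧ (∅ : Set α) ∈ sval C ν g''))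

def upwardsDeterministic (C : HybridCircuit α) : Prop :=
  ∀ (ν : α → Bool) (g g₁ g₂ : α), pureWire C ν g g₁ → pureWire C ν g g₂ → g₁ = g₂

def homogenized (C : HybridCircuit α) : Prop :=
  ¬ ∃ (ν : α → Bool) (g : α), g ∈ C.gates ∧ ¬ (C.τ g).isBoolean ∧ (∅ : Set α) ∈ sval C ν g

noncomputable def fanIn (C : HybridCircuit α) (g : α) : ℕ := {g' | C.wire g' g}.ncard

noncomputable def maxFanIn (C : HybridCircuit α) : ℕ := C.gates.sup (fanIn C)

/-- `Δ(g)`: the gates to which `g` has a directed path. -/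
def deltaSet (C : HybridCircuit α) (g : α) : Set α := {g' | Relation.ReflTransGen C.wire g g'}

/-- The dependency size `Δ(C)`. -/
noncomputable def depSize (C : HybridCircuit α) : ℕ :=
  C.gates.sup fun g => (deltaSet C g).ncard

end MSOEnum

namespace MSOEnum

/-- `deltaRel C d g`: `d` is a set-valued gate that is not a ⊠-gate and has a directed
path to `g` in which all gates other than `d` are ⊠-gates (note that when `C.τ g = box`,
any such path has length ≥ 1 since `d` is not a ⊠-gate). -/
def deltaRel {α : Type} (C : HybridCircuit α) (d g : α) : Prop :=
  ¬ (C.τ d).isBoolean ∧ C.τ d ≠ GateType.box ∧ Relation.ReflTransGen (boxStep C) d g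

theorem mem_sval_of_box (C : HybridCircuit α) (ν : α → Bool) {g : α}
    (hτ : C.τ g = GateType.box) (a : Set α) :
    a ∈ sval C ν g ↔
      (∃ g', C.wire g' g ∧ ¬ (C.τ g').isBoolean ∧ a ∈ sval C ν g') ∧
        ∀ g'', C.wire g'' g → (C.τ g'').isBoolean → bval C ν g'' = true := by
  have h : sval C ν g =
      {a | (∃ g', ∃ _ : C.wire g' g, ¬ (C.τ g').isBoolean ∧ a ∈ sval C ν g') ∧
        ∀ g'', C.wire g'' g → (C.τ g'').isBoolean → bval C ν g'' = true} := by
    rw [sval, C.acyclic.fix_eq]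
    simp only [hτ]
  rw [h]
  simp only [Set.mem_ofPred_eq, exists_prop]

/-- A ⊠-gate has exactly one set-valued input. -/
theorem existsUnique_setValued_input (C : HybridCircuit α) {g : α} (hg : g ∈ C.gates)
    (hτ : C.τ g = GateType.box) : ∃! s, C.wire s g ∧ ¬ (C.τ s).isBoolean := by
  obtain ⟨gs, gb, hs, hb, hws, -, hall⟩ := C.box_inputs g hg hτ
  refine ⟨gs, ⟨hws, hs⟩, ?_⟩
  rintro s ⟨hw, hns⟩
  rcases hall s hw with rfl | rfl
  · rfl
  · exact absurd hb hns

theorem not_isBoolean_of_box {t : GateType} (h : t = GateType.box) : ¬ t.isBoolean := by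
  subst h
  exact id

/-- All gates on a ⊠-path that starts at a set-valued gate are set-valued. -/
theorem not_isBoolean_of_boxPath (C : HybridCircuit α) {d b : α} (hd : ¬ (C.τ d).isBoolean)
    (h : Relation.ReflTransGen (boxStep C) d b) : ¬ (C.τ b).isBoolean := by
  cases h with
  | refl => exact hd
  | tail _ hstep => exact not_isBoolean_of_box hstep.2

theorem sval_eq_of_boxStep (C : HybridCircuit α) {ν : α → Bool} {s g : α}
    (hs : ¬ (C.τ s).isBoolean) (h : boxStep C s g) (hne : (sval C ν g).Nonempty) :
    sval C ν g = sval C ν s := by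
  obtain ⟨hw, hτ⟩ := h
  obtain ⟨x, hx⟩ := hne
  have hbool := ((mem_sval_of_box C ν hτ x).1 hx).2
  have huniq := existsUnique_setValued_input C (C.wire_mem s g hw).2 hτ
  ext a
  rw [mem_sval_of_box C ν hτ]
  constructor
  · rintro ⟨⟨g', hw', hs', ha⟩, -⟩
    rwa [huniq.unique ⟨hw, hs⟩ ⟨hw', hs'⟩]
  · exact fun ha => ⟨⟨s, hw, hs, ha⟩, hbool⟩

theorem sval_eq_of_boxPath (C : HybridCircuit α) {ν : α → Bool} {d g : α}
    (hd : ¬ (C.τ d).isBoolean) (h : Relation.ReflTransGen (boxStep C) d g)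
    (hne : (sval C ν g).Nonempty) : sval C ν g = sval C ν d := by
  induction h with
  | refl => rfl
  | tail hpath hstep ih =>
    have heq := sval_eq_of_boxStep C (not_isBoolean_of_boxPath C hd hpath) hstep hne
    rw [heq] at hne ⊢
    exact ih hne

theorem existsUnique_deltaRel (C : HybridCircuit α) (g : α) (hg : g ∈ C.gates)
    (hset : ¬ (C.τ g).isBoolean) : ∃! d, deltaRel C d g := by
  induction g using C.acyclic.induction with
  | _ g ih =>
  by_cases hτ : C.τ g = GateType.box
  · obtain ⟨s, ⟨hw, hs⟩, huniq⟩ := existsUnique_setValued_input C hg hτ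
    obtain ⟨d, ⟨hd, hdbox, hpath⟩, hduniq⟩ := ih s hw (C.wire_mem s g hw).1 hs
    refine ⟨d, ⟨hd, hdbox, hpath.tail ⟨hw, hτ⟩⟩, ?_⟩
    rintro e ⟨he, hebox, hepath⟩
    cases hepath with
    | refl => exact absurd hτ hebox
    | tail hpath' hstep =>
      obtain rfl := huniq _ ⟨hstep.1, not_isBoolean_of_boxPath C he hpath'⟩
      exact hduniq e ⟨he, hebox, hpath'⟩
  · refine ⟨g, ⟨hset, hτ, .refl⟩, ?_⟩
    rintro e ⟨-, -, hepath⟩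
    cases hepath with
    | refl => rfl
    | tail _ hstep => exact absurd hstep.2 hτ

/-- for every ⊠-gate `g` of a hybrid circuit `C` there is exactly one
set-valued gate `δ(g)` that is not a ⊠-gate and has a directed path to `g` all of whose
gates other than `δ(g)` are ⊠-gates; moreover for every valuation `ν` with `⟦g⟧_ν ≠ ∅`
we have `⟦g⟧_ν = ⟦δ(g)⟧_ν`. -/
theorem shortcut_exists_unique {α : Type} (C : HybridCircuit α)
    (g : α) (hg : g ∈ C.gates) (hτ : C.τ g = GateType.box) :
    (∃! d, deltaRel C d g) ∧
    (∀ d, deltaRel C d g → ∀ ν : α → Bool, (sval C ν g).Nonempty →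
      sval C ν g = sval C ν d) := by
  refine ⟨existsUnique_deltaRel C g hg (not_isBoolean_of_box hτ), ?_⟩
  rintro d ⟨hd, -, hpath⟩ ν hne
  exact sval_eq_of_boxPath C hd hpath hne

end MSOEnum
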